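/- arXiv:2107.03196 — 3 statements merged into one kernel-verified Lean document; each statement's English description precedes it below -/
import Mathlib

section
/- Let r be an N×N complex positive semidefinite Hermitian matrix and set M := r + (1/2)·1_N. Define the 2N×2N complex matrix V := T† M T + Tᵀ M̄ T*, where T*, Tᵀ, T†, M̄ denote entrywise conjugate, transpose, conjugate transpose, and entrywise conjugate respectively. Then: (i) every entry of V is real; (ii) V is symmetric; (iii) V + (i/2)J is positive semidefinite; and (iv) T V T† = M, i.e. T V T† − (1/2)·1_N = r. (Every positive semidefinite correlation matrix arises from a covariance matrix satisfying the Heisenberg uncertainty principle; used in the proof of Proposition 4.) -/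
open Matrix
open scoped ComplexOrder

/-- The transfer matrix `T`: the `N × 2N` complex matrix with (0-indexed) entries
`T k (2k) = 1/√2`, `T k (2k+1) = i/√2`, and all other entries zero. -/
noncomputable def transferMatrix (N : ℕ) : Matrix (Fin N) (Fin (2 * N)) ℂ :=
  Matrix.of fun k j =>
    if (j : ℕ) = 2 * (k : ℕ) then (Real.sqrt 2 : ℂ)⁻¹
    else if (j : ℕ) = 2 * (k : ℕ) + 1 then Complex.I * (Real.sqrt 2 : ℂ)⁻¹
    else 0

/-- The symplectic form `J`: the `2N × 2N` complex matrix given by the direct sum of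
`N` copies of the block `J₂ = [[0,1],[−1,0]]`. -/
def symplecticForm (N : ℕ) : Matrix (Fin (2 * N)) (Fin (2 * N)) ℂ :=
  Matrix.of fun i j =>
    if (i : ℕ) % 2 = 0 ∧ (j : ℕ) = (i : ℕ) + 1 then 1
    else if (j : ℕ) % 2 = 0 ∧ (i : ℕ) = (j : ℕ) + 1 then -1
    else 0

theorem sum_transferMatrix_mul {N : ℕ} (k : Fin N) (g : Fin (2 * N) → ℂ) :
    ∑ j, transferMatrix N k j * g j =
      (Real.sqrt 2 : ℂ)⁻¹ * g ⟨2 * k, by omega⟩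
        + Complex.I * (Real.sqrt 2 : ℂ)⁻¹ * g ⟨2 * k + 1, by omega⟩ := by
  rw [Fintype.sum_eq_add (⟨2 * k, by omega⟩ : Fin (2 * N)) ⟨2 * k + 1, by omega⟩]
  · simp [transferMatrix]
  · simp
  · rintro j ⟨h₁, h₂⟩
    rw [Ne, Fin.ext_iff] at h₁ h₂
    simp [transferMatrix, h₁, h₂]

theorem inv_sqrt_two_mul_self : (Real.sqrt 2 : ℂ)⁻¹ * (Real.sqrt 2 : ℂ)⁻¹ = 1 / 2 := by
  rw [← mul_inv, ← Complex.ofReal_mul, Real.mul_self_sqrt zero_le_two]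
  norm_num

theorem transferMatrix_mul_conjTranspose (N : ℕ) :
    transferMatrix N * (transferMatrix N)ᴴ = 1 := by
  ext k l
  rw [mul_apply, sum_transferMatrix_mul, one_apply]
  by_cases h : k = l
  · subst h
    simp [transferMatrix]
    linear_combination (1 - Complex.I * Complex.I) * inv_sqrt_two_mul_self -
      (1 / 2) * Complex.I_mul_I
  · have h' : (k : ℕ) ≠ l := fun e => h (Fin.ext e)
    have h₁ : 2 * (k : ℕ) ≠ 2 * l + 1 := by omega
    have h₂ : 2 * (k : ℕ) + 1 ≠ 2 * l := by omega
    simp [transferMatrix, h, h', h₁, h₂]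

theorem transferMatrix_mul_transpose (N : ℕ) :
    transferMatrix N * (transferMatrix N)ᵀ = 0 := by
  ext k l
  rw [mul_apply, sum_transferMatrix_mul]
  by_cases h : k = l
  · subst h
    simp [transferMatrix]
    linear_combination (Real.sqrt 2 : ℂ)⁻¹ * (Real.sqrt 2 : ℂ)⁻¹ * Complex.I_mul_I
  · have h' : (k : ℕ) ≠ l := fun e => h (Fin.ext e)
    have h₁ : 2 * (k : ℕ) ≠ 2 * l + 1 := by omega
    have h₂ : 2 * (k : ℕ) + 1 ≠ 2 * l := by omega
    simp [transferMatrix, h', h₁, h₂]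

theorem I_smul_symplecticForm (N : ℕ) :
    Complex.I • symplecticForm N =
      (transferMatrix N)ᴴ * transferMatrix N
        - (transferMatrix N)ᵀ * (transferMatrix N).map (starRingEnd ℂ) := by
  ext i j
  rw [Matrix.sub_apply, mul_apply, mul_apply, ← Finset.sum_sub_distrib,
    Fintype.sum_eq_single (⟨i / 2, by omega⟩ : Fin N)]
  · rcases Nat.mod_two_eq_zero_or_one i with hi | hi
    · have e₁ : (i : ℕ) = 2 * (i / 2) := by omega
      have e₃ : ¬ ((j : ℕ) % 2 = 0 ∧ (i : ℕ) = j + 1) := by omega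
      by_cases h₀ : (j : ℕ) = i
      · simp [transferMatrix, symplecticForm, hi, ← e₁, h₀]
      by_cases h₁ : (j : ℕ) = i + 1
      · simp [transferMatrix, symplecticForm, hi, ← e₁, h₁]
        linear_combination (-2 * Complex.I) * inv_sqrt_two_mul_self
      · simp [transferMatrix, symplecticForm, ← e₁, h₀, h₁, e₃]
    · have e₁ : 2 * ((i : ℕ) / 2) + 1 = i := by omega
      have e₂ : (i : ℕ) ≠ 2 * (i / 2) := by omega
      by_cases h₀ : (j : ℕ) = i
      · simp [transferMatrix, symplecticForm, hi, e₁, e₂, h₀]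
      by_cases h₁ : (j : ℕ) = 2 * (i / 2)
      · simp [transferMatrix, symplecticForm, hi, e₁, e₂, h₁]
        linear_combination (2 * Complex.I) * inv_sqrt_two_mul_self
      · have e₃ : ¬ ((j : ℕ) % 2 = 0 ∧ (i : ℕ) = j + 1) := by omega
        simp [transferMatrix, symplecticForm, hi, e₁, e₂, h₀, h₁, e₃]
  · intro k hk
    rw [Ne, Fin.ext_iff] at hk
    have h₁ : (i : ℕ) ≠ 2 * k := by dsimp at hk; omega
    have h₂ : (i : ℕ) ≠ 2 * k + 1 := by dsimp at hk; omega
    simp [transferMatrix, h₁, h₂]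

/-- every positive semidefinite correlation matrix `r` arises from a real
symmetric covariance matrix `V := T† M T + Tᵀ M̄ T*` (with `M := r + (1/2)·1`) that
satisfies the Heisenberg uncertainty principle `V + (i/2)J ⪰ 0` and `T V T† = M`. -/
theorem covariance_from_correlation (N : ℕ) (hN : 1 ≤ N)
    (r : Matrix (Fin N) (Fin N) ℂ) (hr : r.PosSemidef) :
    ∀ M V : Matrix _ _ ℂ,
      M = r + (1 / 2 : ℂ) • (1 : Matrix (Fin N) (Fin N) ℂ) →
      V = (transferMatrix N)ᴴ * M * transferMatrix N
          + (transferMatrix N)ᵀ * M.map (starRingEnd ℂ)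
            * (transferMatrix N).map (starRingEnd ℂ) →
      (∀ i j, (V i j).im = 0) ∧
      Vᵀ = V ∧
      (V + (Complex.I / 2) • symplecticForm N).PosSemidef ∧
      transferMatrix N * V * (transferMatrix N)ᴴ = M := by
  rintro M V rfl rfl
  set T := transferMatrix N with hT
  set M := r + (1 / 2 : ℂ) • (1 : Matrix (Fin N) (Fin N) ℂ) with hM
  have hMh : Mᴴ = M := by
    simp [hM, hr.isHermitian.eq]
  have hMt : M.map (starRingEnd ℂ) = Mᵀ := by
    conv_rhs => rw [← hMh]
    rfl
  have hTt : (T.map (starRingEnd ℂ))ᵀ = Tᴴ := rfl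
  have hTh : Tᴴᵀ = T.map (starRingEnd ℂ) := rfl
  have hsymm : (Tᴴ * M * T + Tᵀ * M.map (starRingEnd ℂ) * T.map (starRingEnd ℂ))ᵀ =
      Tᴴ * M * T + Tᵀ * M.map (starRingEnd ℂ) * T.map (starRingEnd ℂ) := by
    simp only [hMt, transpose_add, transpose_mul, transpose_transpose, hTt, hTh, Matrix.mul_assoc]
    rw [add_comm]
  have hherm : (Tᴴ * M * T + Tᵀ * M.map (starRingEnd ℂ) * T.map (starRingEnd ℂ))ᴴ =
      Tᴴ * M * T + Tᵀ * M.map (starRingEnd ℂ) * T.map (starRingEnd ℂ) := by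
    have h₁ : (T.map (starRingEnd ℂ))ᴴ = Tᵀ := by ext; simp
    have h₂ : Tᵀᴴ = T.map (starRingEnd ℂ) := rfl
    have h₃ : Mᵀᴴ = Mᵀ := congrArg transpose hMh
    simp only [hMt, conjTranspose_add, conjTranspose_mul, conjTranspose_conjTranspose, h₁, h₂, h₃,
      hMh, Matrix.mul_assoc]
  refine ⟨fun i j => ?_, hsymm, ?_, ?_⟩
  · rw [← Complex.conj_eq_iff_im]
    exact (congrFun (congrFun hherm j) i).trans (congrFun (congrFun hsymm i) j)
  · have hTc : (T.map (starRingEnd ℂ)) = Tᵀᴴ := rfl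
    have key : Tᴴ * M * T + Tᵀ * M.map (starRingEnd ℂ) * T.map (starRingEnd ℂ)
        + (Complex.I / 2) • symplecticForm N =
        Tᴴ * r * T + Tᵀ * rᵀ * T.map (starRingEnd ℂ) + Tᴴ * T := by
      have hJ : (Complex.I / 2) • symplecticForm N =
          (1 / 2 : ℂ) • (Tᴴ * T - Tᵀ * T.map (starRingEnd ℂ)) := by
        rw [← I_smul_symplecticForm, smul_smul]
        congr 1
        ring
      rw [hJ, hMt, hM]
      simp only [transpose_add, transpose_smul, transpose_one, Matrix.mul_add, Matrix.add_mul,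
        Matrix.mul_smul, Matrix.smul_mul, Matrix.mul_one]
      module
    rw [key]
    refine ((hr.conjTranspose_mul_mul_same T).add ?_).add (posSemidef_conjTranspose_mul_self T)
    rw [hTc]
    exact hr.transpose.mul_mul_conjTranspose_same Tᵀ
  · have h₁ : T * Tᴴ = 1 := transferMatrix_mul_conjTranspose N
    have h₂ : T * Tᵀ = 0 := transferMatrix_mul_transpose N
    rw [Matrix.mul_add, Matrix.add_mul]
    simp only [← Matrix.mul_assoc, h₁, h₂, Matrix.zero_mul, add_zero, Matrix.one_mul]
    rw [Matrix.mul_assoc, h₁, Matrix.mul_one]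
end

section
/- Let A be a 2N×2N matrix with real entries, regarded as a complex matrix. Then T A Tᵀ = 0 (the N×N zero matrix) if and only if J A = A J. (The vanishing of the coupling of the reduced state of the field to the conjugate field is equivalent to the commutation condition [J, A] = 0; this is the key equivalence in the proof of Proposition 2.) -/
open Matrix
open scoped ComplexOrder

/-- The even (first) coordinate of the `k`-th mode. -/
def evenIndex {N : ℕ} (k : Fin N) : Fin (2 * N) := ⟨2 * k, by omega⟩

/-- The odd (second) coordinate of the `k`-th mode. -/
def oddIndex {N : ℕ} (k : Fin N) : Fin (2 * N) := ⟨2 * k + 1, by omega⟩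

theorem exists_eq_evenIndex_or_oddIndex {N : ℕ} (i : Fin (2 * N)) :
    ∃ k : Fin N, i = evenIndex k ∨ i = oddIndex k := by
  refine ⟨⟨i / 2, by omega⟩, ?_⟩
  simp only [evenIndex, oddIndex, Fin.ext_iff]
  omega

theorem transferMatrix_apply {N : ℕ} (k : Fin N) (j : Fin (2 * N)) :
    transferMatrix N k j = (if j = evenIndex k then (Real.sqrt 2 : ℂ)⁻¹ else 0) +
      (if j = oddIndex k then Complex.I * (Real.sqrt 2 : ℂ)⁻¹ else 0) := by
  simp only [transferMatrix, Matrix.of_apply, evenIndex, oddIndex, Fin.ext_iff]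
  split_ifs <;> first | omega | simp

theorem transferMatrix_mul_apply {N : ℕ} {m : Type*} (M : Matrix (Fin (2 * N)) m ℂ)
    (k : Fin N) (j : m) :
    (transferMatrix N * M) k j =
      (Real.sqrt 2 : ℂ)⁻¹ * (M (evenIndex k) j + Complex.I * M (oddIndex k) j) := by
  simp only [Matrix.mul_apply, transferMatrix_apply, add_mul, Finset.sum_add_distrib, ite_mul,
    zero_mul, Finset.sum_ite_eq', Finset.mem_univ, if_true]
  ring

theorem mul_transferMatrix_transpose_apply {N : ℕ} {m : Type*} (M : Matrix m (Fin (2 * N)) ℂ)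
    (i : m) (k : Fin N) :
    (M * (transferMatrix N)ᵀ) i k =
      (Real.sqrt 2 : ℂ)⁻¹ * (M i (evenIndex k) + Complex.I * M i (oddIndex k)) := by
  rw [← Matrix.transpose_apply (M * _), Matrix.transpose_mul, Matrix.transpose_transpose,
    transferMatrix_mul_apply]
  rfl

theorem symplecticForm_evenIndex_apply {N : ℕ} (k : Fin N) (j : Fin (2 * N)) :
    symplecticForm N (evenIndex k) j = if j = oddIndex k then 1 else 0 := by
  simp only [symplecticForm, Matrix.of_apply, evenIndex, oddIndex, Fin.ext_iff]
  split_ifs <;> first | rfl | omega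

theorem symplecticForm_oddIndex_apply {N : ℕ} (k : Fin N) (j : Fin (2 * N)) :
    symplecticForm N (oddIndex k) j = if j = evenIndex k then -1 else 0 := by
  simp only [symplecticForm, Matrix.of_apply, evenIndex, oddIndex, Fin.ext_iff]
  split_ifs <;> first | rfl | omega

theorem symplecticForm_transpose (N : ℕ) : (symplecticForm N)ᵀ = -symplecticForm N := by
  ext i j
  simp only [symplecticForm, Matrix.transpose_apply, Matrix.neg_apply, Matrix.of_apply]
  split_ifs <;> first | omega | simp

theorem symplecticForm_mul_evenIndex {N : ℕ} {m : Type*} (M : Matrix (Fin (2 * N)) m ℂ)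
    (k : Fin N) (j : m) : (symplecticForm N * M) (evenIndex k) j = M (oddIndex k) j := by
  simp [Matrix.mul_apply, symplecticForm_evenIndex_apply]

theorem symplecticForm_mul_oddIndex {N : ℕ} {m : Type*} (M : Matrix (Fin (2 * N)) m ℂ)
    (k : Fin N) (j : m) : (symplecticForm N * M) (oddIndex k) j = -M (evenIndex k) j := by
  simp [Matrix.mul_apply, symplecticForm_oddIndex_apply]

theorem mul_symplecticForm_eq {N : ℕ} {m : Type*} (M : Matrix m (Fin (2 * N)) ℂ) :
    M * symplecticForm N = -(symplecticForm N * Mᵀ)ᵀ := by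
  rw [Matrix.transpose_mul, Matrix.transpose_transpose, symplecticForm_transpose, Matrix.mul_neg,
    neg_neg]

theorem mul_symplecticForm_evenIndex {N : ℕ} {m : Type*} (M : Matrix m (Fin (2 * N)) ℂ)
    (i : m) (k : Fin N) : (M * symplecticForm N) i (evenIndex k) = -M i (oddIndex k) := by
  rw [mul_symplecticForm_eq, Matrix.neg_apply, Matrix.transpose_apply,
    symplecticForm_mul_evenIndex]
  rfl

theorem mul_symplecticForm_oddIndex {N : ℕ} {m : Type*} (M : Matrix m (Fin (2 * N)) ℂ)
    (i : m) (k : Fin N) : (M * symplecticForm N) i (oddIndex k) = M i (evenIndex k) := by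
  rw [mul_symplecticForm_eq, Matrix.neg_apply, Matrix.transpose_apply,
    symplecticForm_mul_oddIndex]
  exact neg_neg _

theorem symplecticForm_commutes_iff {N : ℕ} (A : Matrix (Fin (2 * N)) (Fin (2 * N)) ℂ) :
    symplecticForm N * A = A * symplecticForm N ↔
      ∀ k l : Fin N, A (evenIndex k) (evenIndex l) = A (oddIndex k) (oddIndex l) ∧
        A (oddIndex k) (evenIndex l) = -A (evenIndex k) (oddIndex l) := by
  constructor
  · intro h k l
    have h₁ := congrFun₂ h (evenIndex k) (oddIndex l)
    have h₂ := congrFun₂ h (evenIndex k) (evenIndex l)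
    rw [symplecticForm_mul_evenIndex, mul_symplecticForm_oddIndex] at h₁
    rw [symplecticForm_mul_evenIndex, mul_symplecticForm_evenIndex] at h₂
    exact ⟨h₁.symm, h₂⟩
  · intro h
    ext i j
    obtain ⟨k, rfl | rfl⟩ := exists_eq_evenIndex_or_oddIndex i <;>
    obtain ⟨l, rfl | rfl⟩ := exists_eq_evenIndex_or_oddIndex j <;>
    simp [symplecticForm_mul_evenIndex, symplecticForm_mul_oddIndex,
      mul_symplecticForm_evenIndex, mul_symplecticForm_oddIndex, h k l]

theorem transferMatrix_mul_mul_transpose_apply {N : ℕ}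
    (A : Matrix (Fin (2 * N)) (Fin (2 * N)) ℂ) (k l : Fin N) :
    (transferMatrix N * A * (transferMatrix N)ᵀ) k l = ((Real.sqrt 2 : ℂ)⁻¹) ^ 2 *
      ((A (evenIndex k) (evenIndex l) - A (oddIndex k) (oddIndex l)) +
        Complex.I * (A (evenIndex k) (oddIndex l) + A (oddIndex k) (evenIndex l))) := by
  rw [mul_transferMatrix_transpose_apply, transferMatrix_mul_apply, transferMatrix_mul_apply]
  linear_combination ((Real.sqrt 2 : ℂ)⁻¹) ^ 2 * A (oddIndex k) (oddIndex l) * Complex.I_sq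

/-- for a `2N × 2N` matrix `A` with real entries,
`T A Tᵀ = 0` if and only if `J A = A J`. -/
theorem transfer_conjugate_coupling_vanishes_iff_commutes (N : ℕ) (hN : 1 ≤ N)
    (A : Matrix (Fin (2 * N)) (Fin (2 * N)) ℂ) (hA : ∀ i j, (A i j).im = 0) :
    transferMatrix N * A * (transferMatrix N)ᵀ = 0 ↔
      symplecticForm N * A = A * symplecticForm N := by
  rw [symplecticForm_commutes_iff, ← Matrix.ext_iff]
  refine forall₂_congr fun k l => ?_
  rw [transferMatrix_mul_mul_transpose_apply, Matrix.zero_apply, mul_eq_zero,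
    or_iff_right (by simp), Complex.ext_iff, Complex.ext_iff, Complex.ext_iff]
  simp only [Complex.add_re, Complex.add_im, Complex.sub_re, Complex.sub_im, Complex.I_mul_re,
    Complex.I_mul_im, Complex.neg_re, Complex.neg_im, Complex.zero_re, Complex.zero_im, hA]
  constructor
  · rintro ⟨h₁, h₂⟩
    exact ⟨⟨by linarith, trivial⟩, by linarith, by simp⟩
  · rintro ⟨⟨h₁, -⟩, h₂, -⟩
    exact ⟨by linarith, by linarith⟩
end

section
/- Let K be a 2N×2N real matrix and V a 2N×2N real symmetric matrix, both regarded as complex matrices. Set q := T K T†, s := T K Tᵀ, r := T V T† − (1/2)·1_N and c := T V Tᵀ. Then T (K V Kᵀ) T† = q r q† + s rᵀ s† + q c s† + s c† q† + (1/2)(q q† + s s†). (The identity, eq. (A3) of the paper, converting the scattering term of Gaussian evolution with scattering of the matrix of second moments into the language of the reduced state of the field.) -/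
open Matrix
open scoped ComplexOrder

/-- The rows of `T` and of its entrywise conjugate together resolve the identity. -/
lemma transferMatrix_resolution_of_identity (N : ℕ) :
    (transferMatrix N)ᴴ * transferMatrix N
      + (transferMatrix N)ᵀ * (transferMatrix N)ᴴᵀ = 1 := by
  have h2 : ((Real.sqrt 2 : ℂ)⁻¹) * (Real.sqrt 2 : ℂ)⁻¹ = 1 / 2 := by
    rw [← mul_inv, ← Complex.ofReal_mul, Real.mul_self_sqrt (by norm_num)]
    norm_num
  ext i j
  have hi : (i : ℕ) / 2 < N := by omega
  simp only [Matrix.add_apply, mul_apply, conjTranspose_apply, transpose_apply]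
  rw [← Finset.sum_add_distrib, Finset.sum_eq_single ⟨(i : ℕ) / 2, hi⟩]
  · simp only [transferMatrix, of_apply, one_apply, Fin.ext_iff]
    rcases Nat.mod_two_eq_zero_or_one (i : ℕ) with h | h
    · have hi' : (i : ℕ) = 2 * ((i : ℕ) / 2) := by omega
      rw [if_pos hi']
      by_cases h0 : (j : ℕ) = 2 * ((i : ℕ) / 2)
      · rw [if_pos h0, if_pos (by omega)]
        simp only [star_inv₀, Complex.star_def, Complex.conj_ofReal, h2]
        norm_num
      · rw [if_neg h0, if_neg (by omega : ¬ (i : ℕ) = j)]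
        split_ifs
        · simp only [star_mul', star_inv₀, Complex.star_def, Complex.conj_ofReal, Complex.conj_I]
          ring
        · simp
    · have hi' : (i : ℕ) = 2 * ((i : ℕ) / 2) + 1 := by omega
      rw [if_neg (by omega : ¬ (i : ℕ) = 2 * ((i : ℕ) / 2)), if_pos hi']
      by_cases h0 : (j : ℕ) = 2 * ((i : ℕ) / 2)
      · rw [if_pos h0, if_neg (by omega : ¬ (i : ℕ) = j)]
        simp only [star_mul', star_inv₀, Complex.star_def, Complex.conj_ofReal, Complex.conj_I]
        ring
      · rw [if_neg h0]
        by_cases h1 : (j : ℕ) = 2 * ((i : ℕ) / 2) + 1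
        · rw [if_pos h1, if_pos (by omega)]
          simp only [star_mul', star_inv₀, Complex.star_def, Complex.conj_ofReal, Complex.conj_I]
          linear_combination (-2 * Complex.I ^ 2) * h2 - Complex.I_sq
        · rw [if_neg h1, if_neg (by omega : ¬ (i : ℕ) = j)]
          simp
  · intro k _ hk
    have hk' : (k : ℕ) ≠ (i : ℕ) / 2 := fun h => hk (Fin.ext h)
    have : transferMatrix N k i = 0 := by
      simp only [transferMatrix, of_apply]
      rw [if_neg (by omega), if_neg (by omega)]
    simp [this]
  · simp

/-- A complex matrix with real entries has conjugate transpose equal to its transpose. -/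
lemma conjTranspose_eq_transpose_of_im_eq_zero {m n : Type*} (A : Matrix m n ℂ)
    (h : ∀ i j, (A i j).im = 0) : Aᴴ = Aᵀ := by
  ext i j
  simpa [conjTranspose_apply] using Complex.conj_eq_iff_im.mpr (h j i)

/-- eq. (A3), scattering part: for `K` a `2N×2N` real matrix and `V` a
`2N×2N` real symmetric matrix, with `q := T K T†`, `s := T K Tᵀ`,
`r := T V T† − (1/2)·1`, `c := T V Tᵀ`, one has
`T (K V Kᵀ) T† = q r q† + s rᵀ s† + q c s† + s c† q† + (1/2)(q q† + s s†)`. -/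
theorem gaussian_scattering_evolution_RSF (N : ℕ) (hN : 1 ≤ N)
    (K V : Matrix (Fin (2 * N)) (Fin (2 * N)) ℂ)
    (hK : ∀ i j, (K i j).im = 0)
    (hVreal : ∀ i j, (V i j).im = 0) (hVsym : Vᵀ = V) :
    ∀ q s r c : Matrix (Fin N) (Fin N) ℂ,
      q = transferMatrix N * K * (transferMatrix N)ᴴ →
      s = transferMatrix N * K * (transferMatrix N)ᵀ →
      r = transferMatrix N * V * (transferMatrix N)ᴴ
          - (1 / 2 : ℂ) • (1 : Matrix (Fin N) (Fin N) ℂ) →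
      c = transferMatrix N * V * (transferMatrix N)ᵀ →
      transferMatrix N * (K * V * Kᵀ) * (transferMatrix N)ᴴ
        = q * r * qᴴ + s * rᵀ * sᴴ + q * c * sᴴ + s * cᴴ * qᴴ
          + (1 / 2 : ℂ) • (q * qᴴ + s * sᴴ) := by
  rintro q s r c rfl rfl rfl rfl
  have hKt := conjTranspose_eq_transpose_of_im_eq_zero K hK
  have hVt := conjTranspose_eq_transpose_of_im_eq_zero V hVreal
  have hT := transferMatrix_resolution_of_identity N
  generalize transferMatrix N = T at hT ⊢
  have hTt : Tᵀᴴ = Tᴴᵀ := rfl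
  have hmid : K * V * Kᵀ
      = K * (Tᴴ * T + Tᵀ * Tᴴᵀ) * V * (Tᴴ * T + Tᵀ * Tᴴᵀ) * Kᵀ := by
    rw [hT, Matrix.mul_one, Matrix.mul_one]
  rw [hmid]
  simp only [conjTranspose_mul, conjTranspose_conjTranspose, transpose_mul, transpose_sub,
    transpose_smul, transpose_one, hTt, hKt, hVt, hVsym, Matrix.mul_add, Matrix.add_mul,
    Matrix.mul_sub, Matrix.sub_mul, Matrix.mul_smul, Matrix.smul_mul, Matrix.mul_one,
    smul_add, Matrix.mul_assoc]
  abel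
end
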